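/- arXiv:1901.11315 — 4 statements merged into one kernel-verified Lean document; each statement's English description precedes it below -/
import Mathlib

section
/- Let f : ℝ → ℂ be continuous with compact support. Then the Floquet–Bloch transform J f satisfies the Plancherel identity ∫_{-1/2}^{1/2} ∫_{-π}^{π} |(Jf)(α,x)|² dx dα = ∫_{ℝ} |f(t)|² dt; that is, J is an isometry from L²(ℝ) into L²((-1/2,1/2] × (-π,π]). -/
open MeasureTheory Real

/-- The one-dimensional Floquet–Bloch transform with period `2π`:
`(J f)(α, x) = ∑_{j ∈ ℤ} f(x + 2πj) e^{2πi j α}`. -/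
noncomputable def blochTransform (f : ℝ → ℂ) (α x : ℝ) : ℂ :=
  ∑' j : ℤ, f (x + 2 * π * j) * Complex.exp (2 * π * Complex.I * (j : ℂ) * (α : ℂ))

/-- The characters `α ↦ e^{2πi n α}`, `n ∈ ℤ`, integrate to `δ_{n,0}` over one period. -/
lemma integral_exp_two_pi_I_int_mul (n : ℤ) :
    ∫ α in (-(1/2) : ℝ)..(1/2 : ℝ), Complex.exp (2 * π * Complex.I * (n : ℂ) * (α : ℂ)) =
      if n = 0 then 1 else 0 := by
  split_ifs with h
  · subst h
    norm_num
  · have hc : (2 * π * Complex.I * (n : ℂ)) ≠ 0 := by simp [h, pi_ne_zero]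
    rw [integral_exp_mul_complex hc, div_eq_zero_iff, sub_eq_zero]
    left
    rw [Complex.exp_eq_exp_iff_exists_int]
    exact ⟨n, by push_cast; ring⟩

/-- Parseval identity for trigonometric polynomials. -/
lemma integral_norm_sq_sum_exp (s : Finset ℤ) (c : ℤ → ℂ) :
    ∫ α in (-(1/2) : ℝ)..(1/2 : ℝ),
      ‖∑ j ∈ s, c j * Complex.exp (2 * π * Complex.I * (j : ℂ) * (α : ℂ))‖ ^ 2 =
      ∑ j ∈ s, ‖c j‖ ^ 2 := by
  apply Complex.ofReal_injective
  rw [← intervalIntegral.integral_ofReal]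
  have expand (α : ℝ) :
      ((‖∑ j ∈ s, c j * Complex.exp (2 * π * Complex.I * (j : ℂ) * (α : ℂ))‖ ^ 2 : ℝ) : ℂ) =
      ∑ j ∈ s, ∑ k ∈ s, c j * (starRingEnd ℂ) (c k) *
        Complex.exp (2 * π * Complex.I * ((j - k : ℤ) : ℂ) * (α : ℂ)) := by
    rw [Complex.ofReal_pow, ← Complex.mul_conj', map_sum, Finset.sum_mul_sum]
    refine Finset.sum_congr rfl fun j _ => Finset.sum_congr rfl fun k _ => ?_
    rw [map_mul, ← Complex.exp_conj, mul_mul_mul_comm, ← Complex.exp_add]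
    congr 2
    simp only [map_mul, Complex.conj_I, Complex.conj_ofReal, map_ofNat, map_intCast]
    push_cast
    ring
  simp_rw [expand]
  rw [intervalIntegral.integral_finsetSum
    fun j _ => Continuous.intervalIntegrable (by fun_prop) _ _]
  rw [Complex.ofReal_sum]
  refine Finset.sum_congr rfl fun j hj => ?_
  rw [intervalIntegral.integral_finsetSum
    fun k _ => Continuous.intervalIntegrable (by fun_prop) _ _]
  simp_rw [intervalIntegral.integral_const_mul, integral_exp_two_pi_I_int_mul, sub_eq_zero]
  simp [hj, Complex.mul_conj']

/-- Unfolding of an integral over `ℝ` along the translates of `[-π, π]` by `2πℤ`. -/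
lemma hasSum_integral_comp_add_two_pi_mul_int {g : ℝ → ℝ} (hg : Integrable g) :
    HasSum (fun j : ℤ => ∫ x in (-π)..π, g (x + 2 * π * j)) (∫ t, g t) := by
  have h2π : (2 * π : ℝ) ≠ 0 := by positivity
  have hint : Integrable fun t => g (2 * π * t - π) :=
    (hg.comp_sub_right π).comp_mul_left' h2π
  have hscale : 2 * π * ∫ t, g (2 * π * t - π) = ∫ t, g t := by
    rw [Measure.integral_comp_mul_left (fun y => g (y - π)) (2 * π),
      integral_sub_right_eq_self, abs_of_pos (by positivity), smul_eq_mul,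
      mul_inv_cancel_left₀ h2π]
  have hshift (j : ℤ) : ∫ x in (-π)..π, g (x + 2 * π * j) =
      2 * π * ∫ t in (0 : ℝ)..1, g (2 * π * (t + j) - π) := by
    have key := intervalIntegral.mul_integral_comp_mul_sub (a := 0) (b := 1)
      (f := fun y => g (y + 2 * π * j)) (c := 2 * π) (d := π)
    rw [show 2 * π * 0 - π = -π by ring, show 2 * π * 1 - π = π by ring] at key
    rw [← key]
    congr 1
    refine intervalIntegral.integral_congr fun t _ => ?_
    congr 1
    ring
  simp_rw [hshift, ← hscale]
  exact hint.hasSum_intervalIntegral_comp_add_int.mul_left (2 * π)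

/-- Only finitely many translates by `2πℤ` of a compactly supported function are nonzero
somewhere on `[-π, π]`. -/
lemma exists_finset_comp_add_two_pi_mul_int_eq_zero {f : ℝ → ℂ} (hsupp : HasCompactSupport f) :
    ∃ s : Finset ℤ, ∀ j ∉ s, ∀ x ∈ Set.uIcc (-π) π, f (x + 2 * π * j) = 0 := by
  obtain ⟨R, -, hR⟩ := hsupp.exists_pos_le_norm
  refine ⟨Finset.Icc (-⌈R + π⌉) ⌈R + π⌉, fun j hj x hx => hR _ ?_⟩
  rw [Set.uIcc_of_le (by linarith [pi_pos])] at hx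
  have hjabs : R + π < |(j : ℝ)| := by
    rw [Finset.mem_Icc, ← abs_le, not_le] at hj
    calc R + π ≤ ⌈R + π⌉ := Int.le_ceil _
      _ < |(j : ℝ)| := by exact_mod_cast hj
  have hmul : |(j : ℝ)| ≤ |2 * π * j| := by
    rw [abs_mul, abs_of_pos (by positivity : (0 : ℝ) < 2 * π)]
    nlinarith [pi_gt_three, abs_nonneg (j : ℝ)]
  have hx' : |x| ≤ π := abs_le.mpr hx
  have htri : |2 * π * j| - |-x| ≤ |2 * π * j - -x| := abs_sub_abs_le_abs_sub _ _
  rw [abs_neg, sub_neg_eq_add, add_comm (2 * π * (j : ℝ))] at htri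
  rw [Real.norm_eq_abs]
  linarith

/-- Plancherel identity for the Floquet–Bloch transform: for `f : ℝ → ℂ` continuous with
compact support,
`∫_{-1/2}^{1/2} ∫_{-π}^{π} |(Jf)(α,x)|² dx dα = ∫_ℝ |f(t)|² dt`,
i.e. `J` is an isometry from `L²(ℝ)` into `L²((-1/2,1/2] × (-π,π])`. -/
theorem bloch_plancherel (f : ℝ → ℂ) (hf : Continuous f) (hsupp : HasCompactSupport f) :
    (∫ α in (-(1/2) : ℝ)..(1/2 : ℝ), ∫ x in (-π)..π, ‖blochTransform f α x‖ ^ 2) =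
      ∫ t : ℝ, ‖f t‖ ^ 2 := by
  obtain ⟨s, hs⟩ := exists_finset_comp_add_two_pi_mul_int_eq_zero hsupp
  have hJ (α x : ℝ) (hx : x ∈ Set.uIcc (-π) π) : blochTransform f α x =
      ∑ j ∈ s, f (x + 2 * π * j) * Complex.exp (2 * π * Complex.I * (j : ℂ) * (α : ℂ)) :=
    tsum_eq_sum fun j hj => by rw [hs j hj x hx, zero_mul]
  have hint : Integrable fun t => ‖f t‖ ^ 2 :=
    (by fun_prop : Continuous fun t => ‖f t‖ ^ 2).integrable_of_hasCompactSupport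
      (hsupp.comp_left (g := fun z : ℂ => ‖z‖ ^ 2) (by simp))
  calc
    _ = ∫ α in (-(1/2) : ℝ)..(1/2 : ℝ), ∫ x in (-π)..π,
          ‖∑ j ∈ s, f (x + 2 * π * j) *
            Complex.exp (2 * π * Complex.I * (j : ℂ) * (α : ℂ))‖ ^ 2 :=
      intervalIntegral.integral_congr fun α _ =>
        intervalIntegral.integral_congr fun x hx => by simp only [hJ α x hx]
    _ = ∫ x in (-π)..π, ∑ j ∈ s, ‖f (x + 2 * π * j)‖ ^ 2 := by
      rw [intervalIntegral_intervalIntegral_swap]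
      · simp_rw [integral_norm_sq_sum_exp]
      · exact ((by fun_prop : Continuous _).continuousOn.integrableOn_compact
          (isCompact_uIcc.prod isCompact_uIcc)).mono_set
          (Set.prod_mono Set.uIoc_subset_uIcc Set.uIoc_subset_uIcc)
    _ = ∑ j ∈ s, ∫ x in (-π)..π, ‖f (x + 2 * π * j)‖ ^ 2 :=
      intervalIntegral.integral_finsetSum
        fun j _ => Continuous.intervalIntegrable (by fun_prop) _ _
    _ = ∫ t : ℝ, ‖f t‖ ^ 2 := by
      refine (hasSum_sum_of_ne_finset_zero fun j hj => ?_).unique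
        (hasSum_integral_comp_add_two_pi_mul_int hint)
      rw [intervalIntegral.integral_congr (g := fun _ => 0) fun x hx => by simp [hs j hj x hx]]
      simp
end

section
/- Let f : ℝ → ℂ be continuous with compact support and let h : [-1/2,1/2] × [-π,π] → ℂ be continuous. Then ∫_{-1/2}^{1/2} ∫_{-π}^{π} (Jf)(α,x) · conj(h(α,x)) dx dα = Σ_{j∈ℤ} ∫_{-π}^{π} f(x + 2πj) · conj( ∫_{-1/2}^{1/2} h(α,x) e^{-2πi j α} dα ) dx; that is, the inverse Bloch transform coincides with the adjoint of J with respect to the L² inner products. -/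
open MeasureTheory Real

/-- Only finitely many `2π`-translates of a compactly supported function are nonzero somewhere on
`[-π, π]`. -/
lemma exists_finset_translate_eq_zero {f : ℝ → ℂ} (hsupp : HasCompactSupport f) :
    ∃ S : Finset ℤ, ∀ j ∉ S, ∀ x ∈ Set.Icc (-π) π, f (x + 2 * π * j) = 0 := by
  obtain ⟨R, hR⟩ := hsupp.isCompact.isBounded.exists_norm_le
  refine ⟨Finset.Icc (-(⌈R⌉ + 1)) (⌈R⌉ + 1), fun j hj x hx => ?_⟩
  by_contra hne
  have hle := abs_le.1 (hR _ (subset_tsupport f hne))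
  refine hj (Finset.mem_Icc.2 ?_)
  have hc := Int.le_ceil R
  have hpi := Real.pi_gt_three
  have hR0 : 0 ≤ R := (norm_nonneg _).trans (hR _ (subset_tsupport f hne))
  constructor
  · by_contra! hlt
    have hlt' : (j : ℝ) < -((⌈R⌉ : ℝ) + 1) := by exact_mod_cast hlt
    nlinarith [hx.1, hx.2, hle.1, hle.2]
  · by_contra! hlt
    have hlt' : (⌈R⌉ : ℝ) + 1 < (j : ℝ) := by exact_mod_cast hlt
    nlinarith [hx.1, hx.2, hle.1, hle.2]

/-- A continuous function on a closed rectangle extends continuously to the plane. -/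
lemma ContinuousOn.exists_continuous_extend_rectangle {h : ℝ × ℝ → ℂ} {a b c d : ℝ}
    (hab : a ≤ b) (hcd : c ≤ d) (hh : ContinuousOn h (Set.Icc a b ×ˢ Set.Icc c d)) :
    ∃ H : ℝ × ℝ → ℂ, Continuous H ∧
      ∀ s ∈ Set.Icc a b, ∀ t ∈ Set.Icc c d, h (s, t) = H (s, t) := by
  refine ⟨fun p => h (Set.projIcc a b hab p.1, Set.projIcc c d hcd p.2), ?_, ?_⟩
  · refine hh.comp_continuous ?_ fun p => ⟨Subtype.coe_prop _, Subtype.coe_prop _⟩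
    exact (continuous_subtype_val.comp (continuous_projIcc.comp continuous_fst)).prodMk
      (continuous_subtype_val.comp (continuous_projIcc.comp continuous_snd))
  · intro s hs t ht
    simp only [Set.projIcc_of_mem hab hs, Set.projIcc_of_mem hcd ht]

/-- The interval integrals of a jointly continuous function may be interchanged. -/
lemma Continuous.intervalIntegral_swap {F : ℝ → ℝ → ℂ} (hF : Continuous F.uncurry)
    (a b c d : ℝ) :
    ∫ s in a..b, ∫ t in c..d, F s t = ∫ t in c..d, ∫ s in a..b, F s t := by
  refine intervalIntegral_intervalIntegral_swap ?_
  exact (hF.continuousOn.integrableOn_compact (isCompact_uIcc.prod isCompact_uIcc)).mono_set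
    (Set.prod_mono Set.uIoc_subset_uIcc Set.uIoc_subset_uIcc)

/-- The inverse Bloch transform coincides with the adjoint of `J` with respect to the `L²`
inner products: for `f : ℝ → ℂ` continuous with compact support and
`h : [-1/2,1/2] × [-π,π] → ℂ` continuous,
`∫_{-1/2}^{1/2} ∫_{-π}^{π} (Jf)(α,x) conj(h(α,x)) dx dα
  = ∑_{j∈ℤ} ∫_{-π}^{π} f(x+2πj) conj( ∫_{-1/2}^{1/2} h(α,x) e^{-2πi j α} dα ) dx`. -/
theorem bloch_adjoint (f : ℝ → ℂ) (hf : Continuous f) (hsupp : HasCompactSupport f)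
    (h : ℝ × ℝ → ℂ)
    (hh : ContinuousOn h (Set.Icc (-(1/2) : ℝ) (1/2 : ℝ) ×ˢ Set.Icc (-π) π)) :
    (∫ α in (-(1/2) : ℝ)..(1/2 : ℝ), ∫ x in (-π)..π,
        blochTransform f α x * (starRingEnd ℂ) (h (α, x))) =
      ∑' j : ℤ, ∫ x in (-π)..π,
        f (x + 2 * π * j) *
          (starRingEnd ℂ) (∫ α in (-(1/2) : ℝ)..(1/2 : ℝ),
            h (α, x) * Complex.exp (-(2 * π * Complex.I * (j : ℂ) * (α : ℂ)))) := by
  have hI : (-(1/2) : ℝ) ≤ 1/2 := by norm_num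
  have hP : -π ≤ π := by linarith [Real.pi_pos]
  obtain ⟨S, hS⟩ := exists_finset_translate_eq_zero hsupp
  obtain ⟨H, hH, hHh⟩ := hh.exists_continuous_extend_rectangle hI hP
  let G : ℤ → ℝ → ℝ → ℂ := fun j α x =>
    f (x + 2 * π * j) * Complex.exp (2 * π * Complex.I * (j : ℂ) * (α : ℂ)) *
      (starRingEnd ℂ) (H (α, x))
  have hG : ∀ j, Continuous (G j).uncurry := by
    intro j
    have hstar : Continuous fun p : ℝ × ℝ => (starRingEnd ℂ) (H p) :=
      Complex.continuous_conj.comp hH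
    simp only [G, Function.uncurry_def]
    fun_prop
  have hleft : ∀ α ∈ Set.Icc (-(1/2) : ℝ) (1/2), ∀ x ∈ Set.Icc (-π) π,
      blochTransform f α x * (starRingEnd ℂ) (h (α, x)) = ∑ j ∈ S, G j α x := by
    intro α hα x hx
    rw [blochTransform, tsum_eq_sum fun j hj => by rw [hS j hj x hx, zero_mul],
      Finset.sum_mul, hHh α hα x hx]
  have hright : ∀ (j : ℤ), ∀ x ∈ Set.Icc (-π) π,
      f (x + 2 * π * j) *
          (starRingEnd ℂ) (∫ α in (-(1/2) : ℝ)..(1/2 : ℝ),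
            h (α, x) * Complex.exp (-(2 * π * Complex.I * (j : ℂ) * (α : ℂ)))) =
        ∫ α in (-(1/2) : ℝ)..(1/2 : ℝ), G j α x := by
    intro j x hx
    rw [← intervalIntegral.intervalIntegral_conj, ← intervalIntegral.integral_const_mul]
    refine intervalIntegral.integral_congr fun α hα => ?_
    rw [Set.uIcc_of_le hI] at hα
    simp only [G, hHh α hα x hx, map_mul, ← Complex.exp_conj, map_neg, Complex.conj_ofReal,
      Complex.conj_I, map_intCast, map_ofNat, mul_neg, neg_mul, neg_neg]
    ring
  calc
    _ = ∫ α in (-(1/2) : ℝ)..(1/2 : ℝ), ∑ j ∈ S, ∫ x in (-π)..π, G j α x := by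
      refine intervalIntegral.integral_congr fun α hα => ?_
      rw [Set.uIcc_of_le hI] at hα
      refine Eq.trans ?_ (intervalIntegral.integral_finsetSum fun j _ =>
        ((hG j).comp (Continuous.prodMk_right α)).intervalIntegrable _ _)
      refine intervalIntegral.integral_congr fun x hx => ?_
      rw [Set.uIcc_of_le hP] at hx
      exact hleft α hα x hx
    _ = ∑ j ∈ S, ∫ x in (-π)..π, ∫ α in (-(1/2) : ℝ)..(1/2 : ℝ), G j α x := by
      rw [intervalIntegral.integral_finsetSum fun j _ =>
        (intervalIntegral.continuous_parametric_intervalIntegral_of_continuous'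
          (hG j) _ _).intervalIntegrable _ _]
      exact Finset.sum_congr rfl fun j _ => (hG j).intervalIntegral_swap _ _ _ _
    _ = ∑ j ∈ S, ∫ x in (-π)..π, f (x + 2 * π * j) *
          (starRingEnd ℂ) (∫ α in (-(1/2) : ℝ)..(1/2 : ℝ),
            h (α, x) * Complex.exp (-(2 * π * Complex.I * (j : ℂ) * (α : ℂ)))) := by
      refine Finset.sum_congr rfl fun j _ => intervalIntegral.integral_congr fun x hx => ?_
      rw [Set.uIcc_of_le hP] at hx
      exact (hright j x hx).symm
    _ = _ := by
      refine (tsum_eq_sum fun j hj => ?_).symm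
      refine (intervalIntegral.integral_congr fun x hx => ?_).trans intervalIntegral.integral_zero
      rw [Set.uIcc_of_le hP] at hx
      rw [hS j hj x hx, zero_mul]
end

section
/- Let U, V ⊆ ℝ² be open sets, let Φ : V → U be a C¹ diffeomorphism, let k ∈ ℝ, and let u, v : U → ℂ be C¹ with v compactly supported in U. Define c_Φ(y) = |det DΦ(y)| and the matrix A_Φ(y) = |det DΦ(y)| · (DΦ(y))⁻¹ ((DΦ(y))⁻¹)ᵀ for y ∈ V. Then ∫_U ( ∇u(x) · conj(∇v(x)) − k² u(x) conj(v(x)) ) dx = ∫_V ( (A_Φ(y) ∇(u∘Φ)(y)) · conj(∇(v∘Φ)(y)) − k² c_Φ(y) (u∘Φ)(y) conj((v∘Φ)(y)) ) dy. -/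
open MeasureTheory Real Matrix

/-- The Jacobian matrix `DΦ(y)` of a map `Φ : ℝ² → ℝ²` at `y`. -/
noncomputable def jacobianMatrix (Φ : (Fin 2 → ℝ) → (Fin 2 → ℝ)) (y : Fin 2 → ℝ) :
    Matrix (Fin 2) (Fin 2) ℝ :=
  Matrix.of fun i j => fderiv ℝ (fun z => Φ z i) y (Pi.single j 1)

/-- The gradient of a complex-valued function on `ℝ²`, applied componentwise to real and
imaginary parts (encoded via the real Fréchet derivative). -/
noncomputable def grad2 (w : (Fin 2 → ℝ) → ℂ) (y : Fin 2 → ℝ) : Fin 2 → ℂ :=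
  fun i => fderiv ℝ w y (Pi.single i 1)

/-- `c_Φ(y) = |det DΦ(y)|`. -/
noncomputable def cCoeff (Φ : (Fin 2 → ℝ) → (Fin 2 → ℝ)) (y : Fin 2 → ℝ) : ℝ :=
  |(jacobianMatrix Φ y).det|

/-- `A_Φ(y) = |det DΦ(y)| · (DΦ(y))⁻¹ ((DΦ(y))⁻¹)ᵀ`. -/
noncomputable def ACoeff (Φ : (Fin 2 → ℝ) → (Fin 2 → ℝ)) (y : Fin 2 → ℝ) :
    Matrix (Fin 2) (Fin 2) ℝ :=
  cCoeff Φ y • ((jacobianMatrix Φ y)⁻¹ * ((jacobianMatrix Φ y)⁻¹)ᵀ)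

theorem toMatrix'_fderiv_eq_jacobianMatrix {Φ : (Fin 2 → ℝ) → (Fin 2 → ℝ)} {y : Fin 2 → ℝ}
    (hΦ : DifferentiableAt ℝ Φ y) :
    LinearMap.toMatrix' (fderiv ℝ Φ y : (Fin 2 → ℝ) →ₗ[ℝ] (Fin 2 → ℝ)) = jacobianMatrix Φ y := by
  ext i j
  have h := (hasFDerivAt_pi'.1 hΦ.hasFDerivAt i).fderiv
  simp [jacobianMatrix, LinearMap.toMatrix'_apply, h]

theorem jacobianMatrix_det_eq_fderiv_det {Φ : (Fin 2 → ℝ) → (Fin 2 → ℝ)} {y : Fin 2 → ℝ}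
    (hΦ : DifferentiableAt ℝ Φ y) : (jacobianMatrix Φ y).det = (fderiv ℝ Φ y).det := by
  rw [← toMatrix'_fderiv_eq_jacobianMatrix hΦ, LinearMap.det_toMatrix']

/-- The chain rule for the gradient. -/
theorem grad2_comp {Φ : (Fin 2 → ℝ) → (Fin 2 → ℝ)} {w : (Fin 2 → ℝ) → ℂ} {y : Fin 2 → ℝ}
    (hw : DifferentiableAt ℝ w (Φ y)) (hΦ : DifferentiableAt ℝ Φ y) :
    grad2 (w ∘ Φ) y = ((jacobianMatrix Φ y).map Complex.ofReal)ᵀ *ᵥ grad2 w (Φ y) := by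
  ext j
  have hcol : fderiv ℝ Φ y (Pi.single j 1) =
      ∑ i, jacobianMatrix Φ y i j • (Pi.single i 1 : Fin 2 → ℝ) := by
    rw [← toMatrix'_fderiv_eq_jacobianMatrix hΦ]
    ext i
    simp [LinearMap.toMatrix'_apply, Finset.sum_apply, Pi.single_apply]
  simp only [grad2, fderiv_comp y hw hΦ, ContinuousLinearMap.comp_apply, hcol, map_sum, map_smul,
    Matrix.mulVec, dotProduct, Matrix.transpose_apply, Matrix.map_apply, Complex.real_smul]

theorem dotProduct_mulVec_inv_mul_inv_transpose {n R : Type*} [Fintype n] [DecidableEq n]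
    [CommRing R] (B : Matrix n n R) (hB : IsUnit B.det) (g h : n → R) :
    ((B⁻¹ * B⁻¹ᵀ) *ᵥ (Bᵀ *ᵥ g)) ⬝ᵥ (Bᵀ *ᵥ h) = g ⬝ᵥ h := by
  rw [Matrix.mulVec_mulVec, Matrix.mul_assoc, ← Matrix.transpose_mul, Matrix.mul_nonsing_inv B hB,
    Matrix.transpose_one, Matrix.mul_one, Matrix.dotProduct_mulVec, Matrix.vecMul_transpose,
    Matrix.mulVec_mulVec, Matrix.mul_nonsing_inv B hB, Matrix.one_mulVec]

theorem map_ofReal_inv {n : Type*} [Fintype n] [DecidableEq n] (J : Matrix n n ℝ)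
    (hJ : IsUnit J.det) : J⁻¹.map Complex.ofReal = (J.map Complex.ofReal)⁻¹ := by
  symm
  apply Matrix.inv_eq_right_inv
  have h := congrArg (fun M => M.map Complex.ofRealHom) (Matrix.mul_nonsing_inv J hJ)
  rw [Matrix.map_mul, Matrix.map_one _ (map_zero _) (map_one _)] at h
  exact h

/-- The pulled-back gradient form is the original one times the Jacobian determinant. -/
theorem sum_ACoeff_mulVec_grad2_comp {Φ : (Fin 2 → ℝ) → (Fin 2 → ℝ)} {u v : (Fin 2 → ℝ) → ℂ}
    {y : Fin 2 → ℝ} (hΦ : DifferentiableAt ℝ Φ y) (hdet : IsUnit (jacobianMatrix Φ y).det)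
    (hu : DifferentiableAt ℝ u (Φ y)) (hv : DifferentiableAt ℝ v (Φ y)) :
    ∑ i, ((ACoeff Φ y).map Complex.ofReal).mulVec (grad2 (u ∘ Φ) y) i *
        (starRingEnd ℂ) (grad2 (v ∘ Φ) y i) =
      (cCoeff Φ y : ℂ) * ∑ i, grad2 u (Φ y) i * (starRingEnd ℂ) (grad2 v (Φ y) i) := by
  set J := jacobianMatrix Φ y with hJ
  set B := J.map Complex.ofReal with hB
  have hBdet : IsUnit B.det := by
    have h : B.det = Complex.ofRealHom J.det := (RingHom.map_det Complex.ofRealHom J).symm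
    rw [h]
    exact hdet.map Complex.ofRealHom
  have hA : (ACoeff Φ y).map Complex.ofReal = (cCoeff Φ y : ℂ) • (B⁻¹ * B⁻¹ᵀ) := by
    rw [hB, ← map_ofReal_inv J hdet]
    ext i j
    simp [ACoeff, ← hJ, Matrix.mul_apply]
  have hconj : (fun i => (starRingEnd ℂ) (grad2 (v ∘ Φ) y i)) =
      Bᵀ *ᵥ fun i => (starRingEnd ℂ) (grad2 v (Φ y) i) := by
    rw [grad2_comp hv hΦ]
    ext i
    simp [Matrix.mulVec, dotProduct, hB, hJ]
  have h := dotProduct_mulVec_inv_mul_inv_transpose B hBdet (grad2 u (Φ y))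
    (fun i => (starRingEnd ℂ) (grad2 v (Φ y) i))
  rw [← hconj, ← grad2_comp hu hΦ] at h
  rw [hA, Matrix.smul_mulVec]
  simp only [Pi.smul_apply, smul_eq_mul, mul_assoc, ← Finset.mul_sum]
  exact congrArg _ h

/-- A differentiable map with a differentiable local left inverse has invertible Jacobian. -/
theorem isUnit_jacobianMatrix_det {Φ Ψ : (Fin 2 → ℝ) → (Fin 2 → ℝ)} {y : Fin 2 → ℝ}
    (hΦ : DifferentiableAt ℝ Φ y) (hΨ : DifferentiableAt ℝ Ψ (Φ y))
    (hinv : Ψ ∘ Φ =ᶠ[nhds y] id) : IsUnit (jacobianMatrix Φ y).det := by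
  have h : (fderiv ℝ Ψ (Φ y)).comp (fderiv ℝ Φ y) = ContinuousLinearMap.id ℝ _ := by
    rw [← fderiv_comp y hΨ hΦ, hinv.fderiv_eq, fderiv_id]
  rw [← toMatrix'_fderiv_eq_jacobianMatrix hΦ]
  have hmul : LinearMap.toMatrix' (fderiv ℝ Ψ (Φ y) : (Fin 2 → ℝ) →ₗ[ℝ] (Fin 2 → ℝ)) *
      LinearMap.toMatrix' (fderiv ℝ Φ y : (Fin 2 → ℝ) →ₗ[ℝ] (Fin 2 → ℝ)) = 1 := by
    rw [← LinearMap.toMatrix'_comp, ← ContinuousLinearMap.toLinearMap_comp, h]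
    exact LinearMap.toMatrix'_id
  exact Matrix.isUnit_det_of_left_inverse hmul

/-- Pullback identity transporting the Helmholtz sesquilinear form from `U` to `V` via a
`C¹` diffeomorphism `Φ : V → U` (with `C¹` inverse `Ψ`): for `u, v : U → ℂ` of class `C¹`
with `v` compactly supported in `U`,
`∫_U (∇u · conj ∇v − k² u conj v) dx
  = ∫_V ((A_Φ ∇(u∘Φ)) · conj ∇(v∘Φ) − k² c_Φ (u∘Φ) conj (v∘Φ)) dy`. -/
theorem pullback_identity (U V : Set (Fin 2 → ℝ)) (hU : IsOpen U) (hV : IsOpen V)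
    (Φ Ψ : (Fin 2 → ℝ) → (Fin 2 → ℝ))
    (hΦ : ContDiffOn ℝ 1 Φ V) (hΨ : ContDiffOn ℝ 1 Ψ U)
    (hbij : Set.BijOn Φ V U)
    (hleft : ∀ y ∈ V, Ψ (Φ y) = y) (hright : ∀ x ∈ U, Φ (Ψ x) = x)
    (k : ℝ) (u v : (Fin 2 → ℝ) → ℂ)
    (hu : ContDiffOn ℝ 1 u U) (hv : ContDiffOn ℝ 1 v U)
    (hvsupp : IsCompact (tsupport v)) (hvU : tsupport v ⊆ U) :
    (∫ x in U, ((∑ i, grad2 u x i * (starRingEnd ℂ) (grad2 v x i)) -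
        (k : ℂ) ^ 2 * u x * (starRingEnd ℂ) (v x))) =
      ∫ y in V, ((∑ i,
          ((ACoeff Φ y).map Complex.ofReal).mulVec (grad2 (u ∘ Φ) y) i *
            (starRingEnd ℂ) (grad2 (v ∘ Φ) y i)) -
        (k : ℂ) ^ 2 * (cCoeff Φ y : ℂ) * (u ∘ Φ) y * (starRingEnd ℂ) ((v ∘ Φ) y)) := by
  have hΦd : ∀ y ∈ V, DifferentiableAt ℝ Φ y := fun y hy =>
    (hΦ.differentiableOn one_ne_zero).differentiableAt (hV.mem_nhds hy)
  rw [← hbij.image_eq, integral_image_eq_integral_abs_det_fderiv_smul volume hV.measurableSet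
    (fun y hy => (hΦd y hy).hasFDerivAt.hasFDerivWithinAt) hbij.injOn]
  refine setIntegral_congr_fun hV.measurableSet fun y hy => ?_
  have hdiff : ∀ {F : Type} [NormedAddCommGroup F] [NormedSpace ℝ F] {w : (Fin 2 → ℝ) → F},
      ContDiffOn ℝ 1 w U → DifferentiableAt ℝ w (Φ y) := fun hw =>
    (hw.differentiableOn one_ne_zero).differentiableAt (hU.mem_nhds (hbij.mapsTo hy))
  have hinv : Ψ ∘ Φ =ᶠ[nhds y] id := by
    filter_upwards [hV.mem_nhds hy] with z hz using hleft z hz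
  have hc : |(fderiv ℝ Φ y).det| = cCoeff Φ y := by
    rw [cCoeff, jacobianMatrix_det_eq_fderiv_det (hΦd y hy)]
  simp only [sum_ACoeff_mulVec_grad2_comp (hΦd y hy)
    (isUnit_jacobianMatrix_det (hΦd y hy) (hdiff hΨ) hinv) (hdiff hu) (hdiff hv), hc,
    Complex.real_smul, Function.comp_apply]
  ring
end

section
/- Let k > 0, H ∈ ℝ, and let s(ξ) = √(k² − ξ²) for |ξ| ≤ k and s(ξ) = i√(ξ² − k²) for |ξ| > k. Let f : ℝ → ℂ be measurable with ∫_ℝ (1 + ξ²) |f(ξ)| dξ < ∞. Define, for x₂ ≥ H, u(x₁,x₂) = (1/2π) ∫_ℝ e^{i ξ x₁ + i s(ξ)(x₂ − H)} f(ξ) dξ. Then: (i) u is twice continuously differentiable on the open half-plane {x₂ > H} and satisfies ∂²u/∂x₁² + ∂²u/∂x₂² + k²u = 0 there; (ii) for every x₂ > H, ∂u/∂x₂(x₁,x₂) = (1/2π) ∫_ℝ i s(ξ) e^{i ξ x₁ + i s(ξ)(x₂ − H)} f(ξ) dξ, so that the field radiated by the upward propagating radiation condition satisfies the Dirichlet-to-Neumann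 relation with symbol i s(ξ). -/
open MeasureTheory Real

/-- The Laplacian of `u : ℝ × ℝ → ℂ`, written as the sum of the two second partial
derivatives `∂²u/∂x₁² + ∂²u/∂x₂²`. -/
noncomputable def laplacian2 (u : ℝ × ℝ → ℂ) (x : ℝ × ℝ) : ℂ :=
  deriv (fun s => deriv (fun t => u (t, x.2)) s) x.1 +
    deriv (fun s => deriv (fun t => u (x.1, t)) s) x.2

/-- The branch of `√(k² − ξ²)` with nonnegative imaginary part: `s(ξ) = √(k² − ξ²)` for
`|ξ| ≤ k` and `s(ξ) = i√(ξ² − k²)` for `|ξ| > k`. -/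
noncomputable def dtnSymbol (k ξ : ℝ) : ℂ :=
  if |ξ| ≤ k then (Real.sqrt (k ^ 2 - ξ ^ 2) : ℂ)
  else Complex.I * (Real.sqrt (ξ ^ 2 - k ^ 2) : ℂ)

/-- The field radiated by the Upward Propagating Radiation Condition:
`u(x₁,x₂) = (1/2π) ∫_ℝ e^{iξx₁ + is(ξ)(x₂−H)} f(ξ) dξ`. -/
noncomputable def uprcField (k H : ℝ) (f : ℝ → ℂ) (x : ℝ × ℝ) : ℂ :=
  ((2 * π : ℝ) : ℂ)⁻¹ *
    ∫ ξ : ℝ, Complex.exp (Complex.I * (ξ : ℂ) * (x.1 : ℂ) +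
      Complex.I * dtnSymbol k ξ * ((x.2 : ℂ) - (H : ℂ))) * f ξ

/-- The superposition `∫ e^{iξx₁ + is(ξ)(x₂−H)} g(ξ) dξ` of plane waves with vertical
wavenumber `s` and density `g`. -/
noncomputable def planeWaveIntegral (H : ℝ) (s g : ℝ → ℂ) (x : ℝ × ℝ) : ℂ :=
  ∫ ξ : ℝ, Complex.exp (Complex.I * (ξ : ℂ) * (x.1 : ℂ) +
    Complex.I * s ξ * ((x.2 : ℂ) - (H : ℂ))) * g ξ

theorem norm_planeWave_le_one {H : ℝ} {s : ℝ → ℂ} (hs : ∀ ξ, 0 ≤ (s ξ).im) (ξ : ℝ)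
    {x : ℝ × ℝ} (hx : H < x.2) :
    ‖Complex.exp (Complex.I * (ξ : ℂ) * (x.1 : ℂ) +
      Complex.I * s ξ * ((x.2 : ℂ) - (H : ℂ)))‖ ≤ 1 := by
  rw [Complex.norm_exp, Real.exp_le_one_iff]
  have : 0 ≤ (s ξ).im * (x.2 - H) := mul_nonneg (hs ξ) (by linarith)
  simpa using this

theorem isOpen_upperHalfPlane (H : ℝ) : IsOpen {x : ℝ × ℝ | H < x.2} :=
  isOpen_lt continuous_const continuous_snd

theorem measurable_planeWave (H : ℝ) {s : ℝ → ℂ} (hsm : Measurable s) (x : ℝ × ℝ) :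
    Measurable fun ξ : ℝ => Complex.exp (Complex.I * (ξ : ℂ) * (x.1 : ℂ) +
      Complex.I * s ξ * ((x.2 : ℂ) - (H : ℂ))) := by
  fun_prop

theorem integrable_planeWave_mul {H : ℝ} {s g : ℝ → ℂ} (hsm : Measurable s)
    (hs : ∀ ξ, 0 ≤ (s ξ).im) (hg : Integrable g) {x : ℝ × ℝ} (hx : H < x.2) :
    Integrable fun ξ : ℝ => Complex.exp (Complex.I * (ξ : ℂ) * (x.1 : ℂ) +
      Complex.I * s ξ * ((x.2 : ℂ) - (H : ℂ))) * g ξ :=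
  hg.bdd_mul (measurable_planeWave H hsm x).aestronglyMeasurable
    (Filter.Eventually.of_forall fun ξ => norm_planeWave_le_one hs ξ hx)

theorem continuousOn_planeWaveIntegral {H : ℝ} {s g : ℝ → ℂ} (hsm : Measurable s)
    (hs : ∀ ξ, 0 ≤ (s ξ).im) (hg : Integrable g) :
    ContinuousOn (planeWaveIntegral H s g) {x : ℝ × ℝ | H < x.2} := by
  refine continuousOn_of_dominated (bound := fun ξ => ‖g ξ‖)
    (fun x hx => (integrable_planeWave_mul hsm hs hg hx).aestronglyMeasurable)
    (fun x hx => Filter.Eventually.of_forall fun ξ => ?_) hg.norm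
    (Filter.Eventually.of_forall fun ξ => by fun_prop)
  rw [norm_mul]
  exact mul_le_of_le_one_left (norm_nonneg _) (norm_planeWave_le_one hs ξ hx)

theorem hasFDerivAt_planeWave (H : ℝ) (s : ℝ → ℂ) (c : ℂ) (ξ : ℝ) (x : ℝ × ℝ) :
    HasFDerivAt (fun x : ℝ × ℝ => Complex.exp (Complex.I * (ξ : ℂ) * (x.1 : ℂ) +
        Complex.I * s ξ * ((x.2 : ℂ) - (H : ℂ))) * c)
      ((ContinuousLinearMap.fst ℝ ℝ ℝ).smulRight
          (Complex.exp (Complex.I * (ξ : ℂ) * (x.1 : ℂ) +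
            Complex.I * s ξ * ((x.2 : ℂ) - (H : ℂ))) * (Complex.I * ξ * c)) +
        (ContinuousLinearMap.snd ℝ ℝ ℝ).smulRight
          (Complex.exp (Complex.I * (ξ : ℂ) * (x.1 : ℂ) +
            Complex.I * s ξ * ((x.2 : ℂ) - (H : ℂ))) * (Complex.I * s ξ * c))) x := by
  have h1 : HasFDerivAt (fun x : ℝ × ℝ => (x.1 : ℂ))
      (Complex.ofRealCLM.comp (ContinuousLinearMap.fst ℝ ℝ ℝ)) x :=
    Complex.ofRealCLM.hasFDerivAt.comp x hasFDerivAt_fst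
  have h2 : HasFDerivAt (fun x : ℝ × ℝ => (x.2 : ℂ))
      (Complex.ofRealCLM.comp (ContinuousLinearMap.snd ℝ ℝ ℝ)) x :=
    Complex.ofRealCLM.hasFDerivAt.comp x hasFDerivAt_snd
  have h := (((h1.const_mul (Complex.I * (ξ : ℂ))).add
    ((h2.sub_const (H : ℂ)).const_mul (Complex.I * s ξ))).cexp).mul_const c
  refine h.congr_fderiv ?_
  ext <;> simp <;> ring

/-- Differentiation under the integral sign for plane wave superpositions. -/
theorem hasFDerivAt_planeWaveIntegral {H : ℝ} {s g : ℝ → ℂ} (hsm : Measurable s)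
    (hs : ∀ ξ, 0 ≤ (s ξ).im) (hg : Integrable g)
    (hg₁ : Integrable fun ξ : ℝ => Complex.I * ξ * g ξ)
    (hg₂ : Integrable fun ξ : ℝ => Complex.I * s ξ * g ξ) {x : ℝ × ℝ} (hx : H < x.2) :
    HasFDerivAt (planeWaveIntegral H s g)
      ((ContinuousLinearMap.fst ℝ ℝ ℝ).smulRight
          (planeWaveIntegral H s (fun ξ => Complex.I * ξ * g ξ) x) +
        (ContinuousLinearMap.snd ℝ ℝ ℝ).smulRight
          (planeWaveIntegral H s (fun ξ => Complex.I * s ξ * g ξ) x)) x := by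
  have i₁ := integrable_planeWave_mul hsm hs hg₁ hx
  have i₂ := integrable_planeWave_mul hsm hs hg₂ hx
  let L₁ := ContinuousLinearMap.smulRightL ℝ (ℝ × ℝ) ℂ (ContinuousLinearMap.fst ℝ ℝ ℝ)
  let L₂ := ContinuousLinearMap.smulRightL ℝ (ℝ × ℝ) ℂ (ContinuousLinearMap.snd ℝ ℝ ℝ)
  have j₁ := L₁.integrable_comp i₁
  have j₂ := L₂.integrable_comp i₂
  have key := hasFDerivAt_integral_of_dominated_of_fderiv_le (𝕜 := ℝ)
    (bound := fun ξ => ‖Complex.I * ξ * g ξ‖ + ‖Complex.I * s ξ * g ξ‖)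
    ((isOpen_upperHalfPlane H).mem_nhds hx)
    (Filter.eventually_of_mem ((isOpen_upperHalfPlane H).mem_nhds hx) fun y hy =>
      (integrable_planeWave_mul hsm hs hg hy).aestronglyMeasurable)
    (integrable_planeWave_mul hsm hs hg hx) (j₁.add j₂).aestronglyMeasurable
    (Filter.Eventually.of_forall fun ξ y hy => ?_) (hg₁.norm.add hg₂.norm)
    (Filter.Eventually.of_forall fun ξ y _ => hasFDerivAt_planeWave H s (g ξ) ξ y)
  · refine key.congr_fderiv ?_
    have e := integral_add j₁ j₂
    rw [L₁.integral_comp_comm i₁, L₂.integral_comp_comm i₂] at e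
    exact e
  · have hle := norm_planeWave_le_one hs ξ hy
    refine (norm_add_le _ _).trans (add_le_add ?_ ?_)
    · rw [ContinuousLinearMap.norm_smulRight_apply, norm_mul]
      exact (mul_le_of_le_one_left (by positivity) (ContinuousLinearMap.norm_fst_le ..)).trans
        (mul_le_of_le_one_left (norm_nonneg _) hle)
    · rw [ContinuousLinearMap.norm_smulRight_apply, norm_mul]
      exact (mul_le_of_le_one_left (by positivity) (ContinuousLinearMap.norm_snd_le ..)).trans
        (mul_le_of_le_one_left (norm_nonneg _) hle)

theorem hasDerivAt_planeWaveIntegral_fst {H : ℝ} {s g : ℝ → ℂ} (hsm : Measurable s)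
    (hs : ∀ ξ, 0 ≤ (s ξ).im) (hg : Integrable g)
    (hg₁ : Integrable fun ξ : ℝ => Complex.I * ξ * g ξ)
    (hg₂ : Integrable fun ξ : ℝ => Complex.I * s ξ * g ξ) (a : ℝ) {b : ℝ} (hb : H < b) :
    HasDerivAt (fun t => planeWaveIntegral H s g (t, b))
      (planeWaveIntegral H s (fun ξ => Complex.I * ξ * g ξ) (a, b)) a := by
  have h := (hasFDerivAt_planeWaveIntegral hsm hs hg hg₁ hg₂
    (x := (a, b)) hb).comp_hasDerivAt a ((hasDerivAt_id a).prodMk (hasDerivAt_const a b))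
  simpa [Function.comp_def] using h

theorem hasDerivAt_planeWaveIntegral_snd {H : ℝ} {s g : ℝ → ℂ} (hsm : Measurable s)
    (hs : ∀ ξ, 0 ≤ (s ξ).im) (hg : Integrable g)
    (hg₁ : Integrable fun ξ : ℝ => Complex.I * ξ * g ξ)
    (hg₂ : Integrable fun ξ : ℝ => Complex.I * s ξ * g ξ) (a : ℝ) {b : ℝ} (hb : H < b) :
    HasDerivAt (fun t => planeWaveIntegral H s g (a, t))
      (planeWaveIntegral H s (fun ξ => Complex.I * s ξ * g ξ) (a, b)) b := by
  have h := (hasFDerivAt_planeWaveIntegral hsm hs hg hg₁ hg₂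
    (x := (a, b)) hb).comp_hasDerivAt b ((hasDerivAt_const b a).prodMk (hasDerivAt_id b))
  simpa [Function.comp_def] using h

/-- Multiplying the density by a factor bounded by the weight costs one power of the weight. -/
theorem integrable_weight_pow_mul_of_succ {s g m : ℝ → ℂ} {n : ℕ} (hsm : Measurable s)
    (hgm : Measurable g) (hm : Measurable m) (hle : ∀ ξ, ‖m ξ‖ ≤ 1 + |ξ| + ‖s ξ‖)
    (hg : Integrable fun ξ : ℝ => (1 + |ξ| + ‖s ξ‖) ^ (n + 1) * ‖g ξ‖) :
    Integrable fun ξ : ℝ => (1 + |ξ| + ‖s ξ‖) ^ n * ‖m ξ * g ξ‖ := by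
  refine hg.mono' (by fun_prop) (Filter.Eventually.of_forall fun ξ => ?_)
  rw [Real.norm_of_nonneg (by positivity), norm_mul, pow_succ, mul_assoc]
  gcongr
  exact hle ξ

theorem integrable_of_weight_pow {s g : ℝ → ℂ} {n : ℕ} (hgm : Measurable g)
    (hg : Integrable fun ξ : ℝ => (1 + |ξ| + ‖s ξ‖) ^ n * ‖g ξ‖) : Integrable g := by
  refine hg.mono' hgm.aestronglyMeasurable (Filter.Eventually.of_forall fun ξ => ?_)
  refine le_mul_of_one_le_left (norm_nonneg _) (one_le_pow₀ ?_)
  linarith [abs_nonneg ξ, norm_nonneg (s ξ)]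

theorem norm_I_mul_ofReal_le (s : ℝ → ℂ) (ξ : ℝ) :
    ‖Complex.I * (ξ : ℂ)‖ ≤ 1 + |ξ| + ‖s ξ‖ := by
  simp only [norm_mul, Complex.norm_I, one_mul, Complex.norm_real, Real.norm_eq_abs]
  linarith [norm_nonneg (s ξ)]

theorem norm_I_mul_le (s : ℝ → ℂ) (ξ : ℝ) : ‖Complex.I * s ξ‖ ≤ 1 + |ξ| + ‖s ξ‖ := by
  simp only [norm_mul, Complex.norm_I, one_mul]
  linarith [abs_nonneg ξ]

theorem contDiffOn_planeWaveIntegral {H : ℝ} {s : ℝ → ℂ} (hsm : Measurable s)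
    (hs : ∀ ξ, 0 ≤ (s ξ).im) (n : ℕ) {g : ℝ → ℂ} (hgm : Measurable g)
    (hg : Integrable fun ξ : ℝ => (1 + |ξ| + ‖s ξ‖) ^ n * ‖g ξ‖) :
    ContDiffOn ℝ n (planeWaveIntegral H s g) {x : ℝ × ℝ | H < x.2} := by
  induction n generalizing g with
  | zero =>
    exact contDiffOn_zero.2 (continuousOn_planeWaveIntegral hsm hs (integrable_of_weight_pow hgm hg))
  | succ n ih =>
    have w₁ := integrable_weight_pow_mul_of_succ (m := fun ξ => Complex.I * ξ) hsm hgm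
      (by fun_prop) (norm_I_mul_ofReal_le s) hg
    have w₂ := integrable_weight_pow_mul_of_succ (m := fun ξ => Complex.I * s ξ) hsm hgm
      (by fun_prop) (norm_I_mul_le s) hg
    have m₁ : Measurable fun ξ : ℝ => Complex.I * ξ * g ξ := by fun_prop
    have m₂ : Measurable fun ξ : ℝ => Complex.I * s ξ * g ξ := by fun_prop
    have hd : ∀ x ∈ {x : ℝ × ℝ | H < x.2}, HasFDerivAt (planeWaveIntegral H s g) _ x :=
      fun x hx => hasFDerivAt_planeWaveIntegral hsm hs (integrable_of_weight_pow hgm hg)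
        (integrable_of_weight_pow m₁ w₁) (integrable_of_weight_pow m₂ w₂) hx
    push_cast
    refine (contDiffOn_succ_iff_fderiv_of_isOpen (isOpen_upperHalfPlane H)).2
      ⟨fun x hx => (hd x hx).differentiableAt.differentiableWithinAt, by simp, ?_⟩
    refine ContDiffOn.congr (ContDiffOn.add ?_ ?_) fun x hx => (hd x hx).fderiv
    · exact (ContinuousLinearMap.smulRightL ℝ (ℝ × ℝ) ℂ
        (ContinuousLinearMap.fst ℝ ℝ ℝ)).contDiff.comp_contDiffOn (ih m₁ w₁)
    · exact (ContinuousLinearMap.smulRightL ℝ (ℝ × ℝ) ℂ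
        (ContinuousLinearMap.snd ℝ ℝ ℝ)).contDiff.comp_contDiffOn (ih m₂ w₂)

theorem measurable_dtnSymbol (k : ℝ) : Measurable (dtnSymbol k) :=
  Measurable.ite (measurableSet_le (by fun_prop) measurable_const) (by fun_prop) (by fun_prop)

theorem dtnSymbol_im_nonneg (k ξ : ℝ) : 0 ≤ (dtnSymbol k ξ).im := by
  unfold dtnSymbol
  split_ifs <;> simp

theorem dtnSymbol_sq {k : ℝ} (hk : 0 < k) (ξ : ℝ) :
    dtnSymbol k ξ ^ 2 = (k : ℂ) ^ 2 - (ξ : ℂ) ^ 2 := by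
  unfold dtnSymbol
  split_ifs with h
  · have : ξ ^ 2 ≤ k ^ 2 := sq_le_sq.2 (by rwa [abs_of_pos hk])
    rw [← Complex.ofReal_pow, Real.sq_sqrt (by linarith)]
    push_cast
    ring
  · have : k ^ 2 ≤ ξ ^ 2 := sq_le_sq.2 (by rw [abs_of_pos hk]; linarith)
    rw [mul_pow, Complex.I_sq, ← Complex.ofReal_pow, Real.sq_sqrt (by linarith)]
    push_cast
    ring

theorem norm_dtnSymbol_le {k : ℝ} (hk : 0 < k) (ξ : ℝ) : ‖dtnSymbol k ξ‖ ≤ k + |ξ| := by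
  refine le_of_sq_le_sq ?_ (by positivity)
  rw [← norm_pow, dtnSymbol_sq hk]
  refine (norm_sub_le _ _).trans ?_
  simp only [norm_pow, Complex.norm_real, Real.norm_eq_abs, abs_of_pos hk]
  nlinarith [mul_nonneg hk.le (abs_nonneg ξ)]

theorem integrable_dtnSymbol_weight {k : ℝ} (hk : 0 < k) {f : ℝ → ℂ} (hfm : Measurable f)
    (hfi : Integrable (fun ξ : ℝ => (1 + ξ ^ 2) * ‖f ξ‖)) :
    Integrable fun ξ : ℝ => (1 + |ξ| + ‖dtnSymbol k ξ‖) ^ 2 * ‖f ξ‖ := by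
  have hsm := measurable_dtnSymbol k
  refine (hfi.const_mul (2 * (1 + k) ^ 2 + 8)).mono' (by fun_prop)
    (Filter.Eventually.of_forall fun ξ => ?_)
  rw [Real.norm_of_nonneg (by positivity), ← mul_assoc]
  refine mul_le_mul_of_nonneg_right ?_ (norm_nonneg _)
  calc (1 + |ξ| + ‖dtnSymbol k ξ‖) ^ 2 ≤ (1 + |ξ| + (k + |ξ|)) ^ 2 := by
        gcongr
        exact norm_dtnSymbol_le hk ξ
    _ ≤ (2 * (1 + k) ^ 2 + 8) * (1 + ξ ^ 2) := by
        rw [← sq_abs ξ]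
        nlinarith [sq_nonneg (1 + k - 2 * |ξ|), mul_nonneg (sq_nonneg (1 + k)) (sq_nonneg |ξ|)]

theorem uprcField_eq_planeWaveIntegral (k H : ℝ) (f : ℝ → ℂ) (x : ℝ × ℝ) :
    uprcField k H f x =
      ((2 * π : ℝ) : ℂ)⁻¹ * planeWaveIntegral H (dtnSymbol k) f x :=
  rfl

/-- For `k > 0` and measurable `f` with `∫ (1+ξ²)|f(ξ)| dξ < ∞`, the UPRC field is `C²` on
the open half-plane `{x₂ > H}` and satisfies the Helmholtz equation there; moreover its
vertical derivative is obtained by multiplying the density by the symbol `i s(ξ)`, which is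
the Dirichlet-to-Neumann relation. -/
theorem uprc_helmholtz_dtn (k H : ℝ) (hk : 0 < k) (f : ℝ → ℂ) (hfm : Measurable f)
    (hfi : Integrable (fun ξ : ℝ => (1 + ξ ^ 2) * ‖f ξ‖)) :
    ContDiffOn ℝ 2 (uprcField k H f) {x : ℝ × ℝ | H < x.2} ∧
    (∀ x ∈ {x : ℝ × ℝ | H < x.2},
      laplacian2 (uprcField k H f) x + (k : ℂ) ^ 2 * uprcField k H f x = 0) ∧
    ∀ x ∈ {x : ℝ × ℝ | H < x.2},
      deriv (fun s : ℝ => uprcField k H f (x.1, s)) x.2 =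
        ((2 * π : ℝ) : ℂ)⁻¹ *
          ∫ ξ : ℝ, Complex.I * dtnSymbol k ξ *
            Complex.exp (Complex.I * (ξ : ℂ) * (x.1 : ℂ) +
              Complex.I * dtnSymbol k ξ * ((x.2 : ℂ) - (H : ℂ))) * f ξ := by
  have hsm := measurable_dtnSymbol k
  have hs := dtnSymbol_im_nonneg k
  have hw := integrable_dtnSymbol_weight hk hfm hfi
  have m₁ : Measurable fun ξ : ℝ => Complex.I * ξ * f ξ := by fun_prop
  have m₂ : Measurable fun ξ : ℝ => Complex.I * dtnSymbol k ξ * f ξ := by fun_prop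
  have mξ : Measurable fun ξ : ℝ => Complex.I * (ξ : ℂ) := by fun_prop
  have ms : Measurable fun ξ : ℝ => Complex.I * dtnSymbol k ξ := by fun_prop
  have bξ := norm_I_mul_ofReal_le (dtnSymbol k)
  have bs := norm_I_mul_le (dtnSymbol k)
  have w₁ := integrable_weight_pow_mul_of_succ hsm hfm mξ bξ hw
  have w₂ := integrable_weight_pow_mul_of_succ hsm hfm ms bs hw
  have i := integrable_of_weight_pow hfm hw
  have i₁ := integrable_of_weight_pow m₁ w₁
  have i₂ := integrable_of_weight_pow m₂ w₂
  have i₁₁ := integrable_of_weight_pow (mξ.mul m₁)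
    (integrable_weight_pow_mul_of_succ hsm m₁ mξ bξ w₁)
  have i₁₂ := integrable_of_weight_pow (ms.mul m₁)
    (integrable_weight_pow_mul_of_succ hsm m₁ ms bs w₁)
  have i₂₁ := integrable_of_weight_pow (mξ.mul m₂)
    (integrable_weight_pow_mul_of_succ hsm m₂ mξ bξ w₂)
  have i₂₂ := integrable_of_weight_pow (ms.mul m₂)
    (integrable_weight_pow_mul_of_succ hsm m₂ ms bs w₂)
  have d₁ : ∀ a b : ℝ, H < b → deriv (fun t => uprcField k H f (t, b)) a =
      ((2 * π : ℝ) : ℂ)⁻¹ *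
        planeWaveIntegral H (dtnSymbol k) (fun ξ => Complex.I * ξ * f ξ) (a, b) :=
    fun a b hb => ((hasDerivAt_planeWaveIntegral_fst hsm hs i i₁ i₂ a hb).const_mul _).deriv
  have d₂ : ∀ a b : ℝ, H < b → deriv (fun t => uprcField k H f (a, t)) b =
      ((2 * π : ℝ) : ℂ)⁻¹ *
        planeWaveIntegral H (dtnSymbol k) (fun ξ => Complex.I * dtnSymbol k ξ * f ξ) (a, b) :=
    fun a b hb => ((hasDerivAt_planeWaveIntegral_snd hsm hs i i₁ i₂ a hb).const_mul _).deriv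
  refine ⟨contDiffOn_const.mul (contDiffOn_planeWaveIntegral hsm hs 2 hfm hw), ?_, ?_⟩
  · rintro ⟨a, b⟩ hb
    have hb : H < b := hb
    have e₁ : (fun t => deriv (fun r => uprcField k H f (r, b)) t) = _ :=
      funext fun t => d₁ t b hb
    have e₂ : (fun t => deriv (fun r => uprcField k H f (a, r)) t) =ᶠ[nhds b] _ :=
      Filter.eventually_of_mem (Ioi_mem_nhds hb) fun t ht => d₂ a t ht
    have dd₁ := ((hasDerivAt_planeWaveIntegral_fst hsm hs i₁ i₁₁ i₁₂ a hb).const_mul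
      ((2 * π : ℝ) : ℂ)⁻¹).deriv
    have dd₂ := ((hasDerivAt_planeWaveIntegral_snd hsm hs i₂ i₂₁ i₂₂ a hb).const_mul
      ((2 * π : ℝ) : ℂ)⁻¹).deriv
    simp only [laplacian2]
    rw [e₁, e₂.deriv_eq, dd₁, dd₂, uprcField_eq_planeWaveIntegral, mul_left_comm,
      ← mul_add, ← mul_add]
    refine mul_eq_zero_of_right _ ?_
    have I₁ := integrable_planeWave_mul (x := (a, b))
      (g := fun ξ => Complex.I * ξ * (Complex.I * ξ * f ξ)) hsm hs i₁₁ hb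
    have I₂ := integrable_planeWave_mul (x := (a, b))
      (g := fun ξ => Complex.I * dtnSymbol k ξ * (Complex.I * dtnSymbol k ξ * f ξ)) hsm hs i₂₂ hb
    have I₀ := (integrable_planeWave_mul (x := (a, b)) hsm hs i hb).const_mul ((k : ℂ) ^ 2)
    unfold planeWaveIntegral
    rw [← integral_const_mul, ← integral_add' I₁ I₂, ← integral_add' (I₁.add I₂) I₀]
    refine integral_eq_zero_of_ae (Filter.Eventually.of_forall fun ξ => ?_)
    simp only [Pi.add_apply, Pi.zero_apply]
    linear_combination
      (Complex.exp (Complex.I * (ξ : ℂ) * (a : ℂ) +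
        Complex.I * dtnSymbol k ξ * ((b : ℂ) - (H : ℂ))) * f ξ) *
      (((ξ : ℂ) ^ 2 + dtnSymbol k ξ ^ 2) * Complex.I_sq - dtnSymbol_sq hk ξ)
  · rintro ⟨a, b⟩ hb
    refine (d₂ a b hb).trans ?_
    congr 1
    refine integral_congr_ae (Filter.Eventually.of_forall fun ξ => ?_)
    ring
end
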